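/- arXiv:2102.03066 — 2 statements merged into one kernel-verified Lean document; each statement's English description precedes it below -/
import Mathlib

section
/- Let δ > 0, let N ≥ 1 be an integer, and let M be a holomorphic function on the open ball B_δ(0) ⊂ ℂ with values in the N×N complex matrices such that for some C > 0 and ρ ∈ (0,1) one has ‖M(z)^j‖ ≤ C ρ^j for every j ∈ ℕ and every z ∈ B_δ(0). Then there exist δ' ∈ (0,δ], C' > 0 and ρ' ∈ (0,1) such that ‖M(z₁)^j - M(z₂)^j‖ ≤ C' |z₁ - z₂| ρ'^j for every j ∈ ℕ and all z₁, z₂ ∈ B_{δ'}(0). -/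
noncomputable section

/-- If `M` is holomorphic on `B_δ(0)` with values in the `N×N` complex matrices
(identified with endomorphisms of `ℂ^N`) and `‖M(z)^j‖ ≤ C ρ^j` uniformly on the ball,
then, up to diminishing the radius, `‖M(z₁)^j - M(z₂)^j‖ ≤ C' |z₁ - z₂| ρ'^j`. -/
theorem power_difference_estimate (N : ℕ) (hN : 1 ≤ N) (δ : ℝ) (hδ : 0 < δ)
    (M : ℂ → ((Fin N → ℂ) →L[ℂ] (Fin N → ℂ)))
    (hol : DifferentiableOn ℂ M (Metric.ball (0:ℂ) δ))
    (C ρ : ℝ) (hC : 0 < C) (hρ₀ : 0 < ρ) (hρ₁ : ρ < 1)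
    (hbound : ∀ j : ℕ, ∀ z ∈ Metric.ball (0:ℂ) δ, ‖(M z) ^ j‖ ≤ C * ρ ^ j) :
    ∃ δ' C' ρ' : ℝ, 0 < δ' ∧ δ' ≤ δ ∧ 0 < C' ∧ 0 < ρ' ∧ ρ' < 1 ∧
      ∀ j : ℕ, ∀ z₁ ∈ Metric.ball (0:ℂ) δ', ∀ z₂ ∈ Metric.ball (0:ℂ) δ',
        ‖(M z₁) ^ j - (M z₂) ^ j‖ ≤ C' * ‖z₁ - z₂‖ * ρ' ^ j := by
  have hd : ∀ j : ℕ, DifferentiableOn ℂ (fun z => (M z) ^ j) (Metric.ball (0:ℂ) δ) :=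
    fun j => hol.fun_pow j
  refine ⟨δ / 2, C / (δ / 4), ρ, by positivity, by linarith, by positivity, hρ₀, hρ₁, ?_⟩
  intro j z₁ hz₁ z₂ hz₂
  have hsub : ∀ z ∈ Metric.ball (0:ℂ) (δ / 2),
      Metric.closedBall z (δ / 4) ⊆ Metric.ball (0:ℂ) δ := by
    intro z hz w hw
    rw [Metric.mem_ball] at hz ⊢
    rw [Metric.mem_closedBall] at hw
    linarith [dist_triangle w z 0]
  have key := Convex.norm_image_sub_le_of_norm_deriv_le (𝕜 := ℂ)
    (f := fun z => (M z) ^ j) (C := C * ρ ^ j / (δ / 4))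
    (s := Metric.ball (0:ℂ) (δ / 2)) (x := z₂) (y := z₁) ?_ ?_ (convex_ball _ _) hz₂ hz₁
  · calc _ ≤ _ := key
      _ = _ := by ring
  · intro z hz
    exact (hd j).differentiableAt
      (Metric.isOpen_ball.mem_nhds (Metric.ball_subset_ball (by linarith) hz))
  · intro z hz
    refine Complex.norm_deriv_le_of_forall_mem_sphere_norm_le (by positivity) ?_ ?_
    · exact ((hd j).mono (hsub z hz)).diffContOnCl_ball subset_rfl
    · intro w hw
      exact hbound j w (hsub z hz (Metric.sphere_subset_closedBall hw))

end
end

section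
/- Let μ ≥ 1 be an integer and let α > 0, β > 0 be real numbers. Let ϖ be a holomorphic function on a neighborhood of 0 in ℂ such that ϖ(τ) = -τ/α + (-1)^{μ+1} (β/α^{2μ+1}) τ^{2μ} + O(|τ|^{2μ+1}) as τ → 0. Then there exist constants 0 < β_* < β < β^* and ε > 0 such that for every τ in the open ball B_ε(0): Re(ϖ(τ)) ≤ -Re(τ)/α + (β^*/α^{2μ+1}) Re(τ)^{2μ} - (β_*/α^{2μ+1}) Im(τ)^{2μ}. -/
noncomputable section

/-- Homogeneous estimate for the real part of an even power. -/
theorem re_pow_lower_aux (m : ℕ) : ∃ C : ℝ, 0 < C ∧ ∀ x y : ℝ,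
    3 / 4 * y ^ (2 * m) - C * x ^ (2 * m)
      ≤ (((y : ℂ) - (x : ℂ) * Complex.I) ^ (2 * m)).re := by
  have hc : Continuous fun t : ℝ => (((1 : ℂ) - (t : ℂ) * Complex.I) ^ (2 * m)).re := by
    fun_prop
  have h0 : ∀ᶠ t : ℝ in nhds 0,
      3 / 4 < (((1 : ℂ) - (t : ℂ) * Complex.I) ^ (2 * m)).re := by
    apply hc.continuousAt.eventually (lt_mem_nhds _)
    norm_num
  obtain ⟨δ, hδ, hball⟩ := Metric.eventually_nhds_iff.1 h0
  refine ⟨2 * (1 + 1 / δ) ^ (2 * m), by positivity, fun x y => ?_⟩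
  have hx0 : 0 ≤ x ^ (2 * m) := (even_two_mul m).pow_nonneg x
  have hy0 : 0 ≤ y ^ (2 * m) := (even_two_mul m).pow_nonneg y
  have hax : |x| ^ (2 * m) = x ^ (2 * m) := (even_two_mul m).pow_abs x
  have hay : |y| ^ (2 * m) = y ^ (2 * m) := (even_two_mul m).pow_abs y
  by_cases hxy : |x| < δ * |y|
  · have hy : y ≠ 0 := by
      rintro rfl
      simp at hxy
      linarith [abs_nonneg x]
    have hyp : 0 < |y| := abs_pos.2 hy
    have ht : dist (x / y) 0 < δ := by
      rw [Real.dist_eq, sub_zero, abs_div, div_lt_iff₀ hyp]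
      exact hxy
    have h1 := hball ht
    have hyc : (y : ℂ) ≠ 0 := by exact_mod_cast hy
    have h2 : ((y : ℂ) - (x : ℂ) * Complex.I)
        = (y : ℂ) * ((1 : ℂ) - ((x / y : ℝ) : ℂ) * Complex.I) := by
      push_cast
      field_simp
    rw [h2, mul_pow, ← Complex.ofReal_pow, Complex.re_ofReal_mul]
    have h3 := mul_le_mul_of_nonneg_left h1.le hy0
    have h4 : 0 ≤ 2 * (1 + 1 / δ) ^ (2 * m) * x ^ (2 * m) := by positivity
    linarith
  · have hxy' : |y| ≤ |x| / δ := by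
      rw [le_div_iff₀ hδ]
      linarith
    have hn : ‖(y : ℂ) - (x : ℂ) * Complex.I‖ ≤ (1 + 1 / δ) * |x| := by
      calc ‖(y : ℂ) - (x : ℂ) * Complex.I‖ ≤ ‖(y : ℂ)‖ + ‖(x : ℂ) * Complex.I‖ := norm_sub_le _ _
        _ = |y| + |x| := by simp
        _ ≤ |x| / δ + |x| := by linarith
        _ = (1 + 1 / δ) * |x| := by ring
    have h1 : ‖((y : ℂ) - (x : ℂ) * Complex.I) ^ (2 * m)‖
        ≤ (1 + 1 / δ) ^ (2 * m) * x ^ (2 * m) := by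
      rw [norm_pow, ← hax, ← mul_pow]
      exact pow_le_pow_left₀ (norm_nonneg _) hn _
    have h2 := Complex.abs_re_le_norm (((y : ℂ) - (x : ℂ) * Complex.I) ^ (2 * m))
    have h3 := neg_abs_le (((y : ℂ) - (x : ℂ) * Complex.I) ^ (2 * m)).re
    have h4 : y ^ (2 * m) ≤ (1 + 1 / δ) ^ (2 * m) * x ^ (2 * m) := by
      rw [← hay, ← hax, ← mul_pow]
      apply pow_le_pow_left₀ (abs_nonneg _)
      calc |y| ≤ |x| / δ := hxy'
        _ ≤ |x| / δ + |x| := by linarith [abs_nonneg x]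
        _ = (1 + 1 / δ) * |x| := by ring
    linarith

/-- The norm is controlled by the coordinates. -/
theorem norm_pow_le_aux (m : ℕ) (τ : ℂ) :
    ‖τ‖ ^ (2 * m) ≤ 2 ^ (2 * m - 1) * (τ.re ^ (2 * m) + τ.im ^ (2 * m)) := by
  have hax : |τ.re| ^ (2 * m) = τ.re ^ (2 * m) := (even_two_mul m).pow_abs _
  have hay : |τ.im| ^ (2 * m) = τ.im ^ (2 * m) := (even_two_mul m).pow_abs _
  rw [← hax, ← hay]
  exact (pow_le_pow_left₀ (norm_nonneg _) (Complex.norm_le_abs_re_add_abs_im τ) _).trans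
    (add_pow_le (abs_nonneg _) (abs_nonneg _) _)

/-- If `ϖ` is holomorphic near `0` with
`ϖ(τ) = -τ/α + (-1)^(μ+1) (β/α^(2μ+1)) τ^(2μ) + O(|τ|^(2μ+1))`, then there are
`0 < β_* < β < β^*` and `ε > 0` such that on `B_ε(0)`:
`Re ϖ(τ) ≤ -Re τ/α + (β^*/α^(2μ+1)) (Re τ)^(2μ) - (β_*/α^(2μ+1)) (Im τ)^(2μ)`. -/
theorem re_varpi_estimate (μ : ℕ) (hμ : 1 ≤ μ) (α β : ℝ) (hα : 0 < α) (hβ : 0 < β)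
    (ϖ : ℂ → ℂ) (U : Set ℂ) (hU : U ∈ nhds (0:ℂ)) (hol : DifferentiableOn ℂ ϖ U)
    (E : ℂ → ℂ)
    (hE : Asymptotics.IsBigO (nhds (0:ℂ)) E (fun τ : ℂ => ‖τ‖ ^ (2*μ+1)))
    (hexp : ∀ᶠ τ : ℂ in nhds 0, ϖ τ =
      -τ / (α:ℂ) + ((-1:ℂ)) ^ (μ+1) * ((β:ℂ) / (α:ℂ) ^ (2*μ+1)) * τ ^ (2*μ) + E τ) :
    ∃ βs βb ε : ℝ, 0 < βs ∧ βs < β ∧ β < βb ∧ 0 < ε ∧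
      ∀ τ ∈ Metric.ball (0:ℂ) ε,
        (ϖ τ).re ≤ -τ.re / α + βb / α ^ (2*μ+1) * τ.re ^ (2*μ)
          - βs / α ^ (2*μ+1) * τ.im ^ (2*μ) := by
  obtain ⟨C, hC, hmain⟩ := re_pow_lower_aux μ
  obtain ⟨M, hM, hEM⟩ := hE.exists_pos
  have hEM' := hEM.bound
  obtain ⟨ε₁, hε₁, hb⟩ := Metric.eventually_nhds_iff.1 (hexp.and hEM')
  set K : ℝ := β / α ^ (2*μ+1) with hK
  have hKp : 0 < K := by positivity
  set N : ℝ := 2 ^ (2 * μ - 1) with hN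
  have hNp : 0 < N := by positivity
  refine ⟨β / 2, β * (C + 1), min ε₁ (K / (4 * M * N)), by positivity, by linarith,
    by nlinarith [mul_pos hβ hC], by positivity, fun τ hτ => ?_⟩
  rw [Metric.mem_ball] at hτ
  obtain ⟨h1, h2⟩ := hb (hτ.trans_le (min_le_left _ _))
  have h3 : ‖τ‖ < K / (4 * M * N) := by
    simpa using hτ.trans_le (min_le_right _ _)
  rw [lt_div_iff₀ (by positivity)] at h3
  have hE1 : (E τ).re ≤ M * (‖τ‖ * ‖τ‖ ^ (2 * μ)) := by
    refine (Complex.re_le_norm _).trans (h2.trans (le_of_eq ?_))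
    rw [Real.norm_of_nonneg (by positivity)]
    ring
  have hS := norm_pow_le_aux μ τ
  have hx0 : 0 ≤ τ.re ^ (2 * μ) := (even_two_mul μ).pow_nonneg _
  have hy0 : 0 ≤ τ.im ^ (2 * μ) := (even_two_mul μ).pow_nonneg _
  set S : ℝ := τ.re ^ (2 * μ) + τ.im ^ (2 * μ) with hSdef
  have hS0 : 0 ≤ S := add_nonneg hx0 hy0
  have hE2 : (E τ).re ≤ K / 4 * S := by
    have e1 : M * (‖τ‖ * ‖τ‖ ^ (2 * μ)) ≤ M * (‖τ‖ * (N * S)) := by gcongr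
    have e2 := mul_le_mul_of_nonneg_right h3.le hS0
    linarith
  have hrot : ((-1:ℂ)) ^ (μ+1) * τ ^ (2*μ)
      = -(((τ.im : ℂ) - (τ.re : ℂ) * Complex.I) ^ (2 * μ)) := by
    have : (τ.im : ℂ) - (τ.re : ℂ) * Complex.I = -Complex.I * τ := by
      apply Complex.ext <;> simp
    rw [this, mul_pow, pow_mul (-Complex.I), neg_sq, Complex.I_sq]
    ring
  have hmid : (((-1:ℂ)) ^ (μ+1) * ((β:ℂ) / (α:ℂ) ^ (2*μ+1)) * τ ^ (2*μ)).re
      = -(K * (((τ.im : ℂ) - (τ.re : ℂ) * Complex.I) ^ (2 * μ)).re) := by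
    have : ((-1:ℂ)) ^ (μ+1) * ((β:ℂ) / (α:ℂ) ^ (2*μ+1)) * τ ^ (2*μ)
        = (K : ℂ) * (((-1:ℂ)) ^ (μ+1) * τ ^ (2*μ)) := by
      rw [hK]
      push_cast
      ring
    rw [this, hrot, Complex.re_ofReal_mul, Complex.neg_re, mul_neg]
  have hfin := mul_le_mul_of_nonneg_left (hmain τ.re τ.im) hKp.le
  have hb1 : β * (C + 1) / α ^ (2*μ+1) = K * (C + 1) := by rw [hK]; ring
  have hb2 : β / 2 / α ^ (2*μ+1) = K / 2 := by rw [hK]; ring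
  rw [h1, Complex.add_re, Complex.add_re, hmid, Complex.div_ofReal_re, Complex.neg_re, hb1, hb2]
  have hKx : 0 ≤ K * τ.re ^ (2 * μ) := by positivity
  rw [hSdef] at hE2
  linarith

end
end
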